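/- Let G be a plane triangulation and let S be a connected dominating set of G. Then the induced subgraph G − S (on vertex set V(G) \ S) is outerplanar; consequently, for a plane triangulation G of order n, s_o(G) ≥ n − γ_c(G). -/

import Mathlib

/-- A drawing (embedding) of a simple graph in the plane `ℝ × ℝ` without crossings:
vertices are mapped to distinct points, each edge to an injective arc joining its
endpoints, arcs pass through no other vertex, and two arcs of distinct edges meet
only in common endpoints. -/
structure PlaneEmbedding {V : Type} (G : SimpleGraph V) where
  vtx : V → ℝ × ℝ
  vtx_inj : Function.Injective vtx
  arc : ∀ ⦃u v : V⦄, G.Adj u v → Set (ℝ × ℝ)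
  arc_symm : ∀ ⦃u v : V⦄ (h : G.Adj u v), arc h.symm = arc h
  arc_path : ∀ ⦃u v : V⦄ (h : G.Adj u v),
    ∃ γ : Path (vtx u) (vtx v), Function.Injective ⇑γ ∧ Set.range ⇑γ = arc h
  arc_vtx : ∀ ⦃u v : V⦄ (h : G.Adj u v) (w : V), vtx w ∈ arc h → w = u ∨ w = v
  arc_inter : ∀ ⦃u v a b : V⦄ (h₁ : G.Adj u v) (h₂ : G.Adj a b), s(u, v) ≠ s(a, b) →
    arc h₁ ∩ arc h₂ ⊆ ({vtx u, vtx v} : Set (ℝ × ℝ)) ∩ {vtx a, vtx b}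

namespace PlaneEmbedding

variable {V : Type} {G : SimpleGraph V}

/-- The point set of the sub-drawing determined by the vertices in `S`
(the inherited embedding of the induced subgraph on `S`). -/
def subSupport (E : PlaneEmbedding G) (S : Set V) : Set (ℝ × ℝ) :=
  E.vtx '' S ∪ ⋃ (u : V) (_ : u ∈ S) (v : V) (_ : v ∈ S) (h : G.Adj u v), E.arc h

/-- The induced subgraph on `S`, with the inherited embedding, is an outerplane graph:
every vertex of `S` lies on the boundary of the outer (unbounded) face, i.e. in the
closure of the set of points belonging to unbounded faces of the sub-drawing. -/
def OuterplaneOn (E : PlaneEmbedding G) (S : Set V) : Prop :=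
  ∀ v ∈ S, E.vtx v ∈ closure {p | p ∉ E.subSupport S ∧
    ¬ Bornology.IsBounded (connectedComponentIn (E.subSupport S)ᶜ p)}

/-- The whole drawing is an outerplane graph. -/
def IsOuterplane (E : PlaneEmbedding G) : Prop := E.OuterplaneOn Set.univ

end PlaneEmbedding

/-- A graph is planar if it admits a plane embedding. -/
def IsPlanar {V : Type} (G : SimpleGraph V) : Prop := Nonempty (PlaneEmbedding G)

/-- A graph is outerplanar if it admits a plane embedding with all vertices on the
boundary of the outer face. -/
def IsOuterplanar {V : Type} (G : SimpleGraph V) : Prop :=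
  ∃ E : PlaneEmbedding G, E.IsOuterplane

/-- A plane triangulation is an edge-maximal (finite) planar graph. -/
def IsPlaneTriangulation {V : Type} (G : SimpleGraph V) : Prop :=
  IsPlanar G ∧ ∀ u v : V, u ≠ v → ¬ G.Adj u v →
    ¬ IsPlanar (G ⊔ SimpleGraph.fromEdgeSet {s(u, v)})

/-- `G` has a `K_m`-minor: there are `m` pairwise disjoint nonempty connected branch
sets with an edge between any two of them. -/
def HasCliqueMinor {V : Type} (G : SimpleGraph V) (m : ℕ) : Prop :=
  ∃ B : Fin m → Set V,
    (∀ i, (B i).Nonempty) ∧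
    (∀ i, (G.induce (B i)).Connected) ∧
    (∀ i j, i ≠ j → Disjoint (B i) (B j)) ∧
    (∀ i j, i ≠ j → ∃ u ∈ B i, ∃ v ∈ B j, G.Adj u v)

/-- `G` is `K₄`-minor free. -/
def K4MinorFree {V : Type} (G : SimpleGraph V) : Prop := ¬ HasCliqueMinor G 4

/-- `s_{o'}(G)` for a fixed plane embedding of `G`: the maximum order of an induced
subgraph whose inherited embedding is an outerplane graph. -/
noncomputable def sO' {V : Type} [Fintype V] {G : SimpleGraph V}
    (E : PlaneEmbedding G) : ℕ :=
  sSup {n | ∃ S : Finset V, E.OuterplaneOn ↑S ∧ S.card = n}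

/-- `s_o(G)`: the maximum order of an induced outerplanar subgraph of `G`. -/
noncomputable def sO {V : Type} [Fintype V] (G : SimpleGraph V) : ℕ :=
  sSup {n | ∃ S : Finset V, IsOuterplanar (G.induce (↑S : Set V)) ∧ S.card = n}

/-- `s_{K₄}(G)`: the maximum order of an induced `K₄`-minor-free subgraph of `G`. -/
noncomputable def sK4 {V : Type} [Fintype V] (G : SimpleGraph V) : ℕ :=
  sSup {n | ∃ S : Finset V, K4MinorFree (G.induce (↑S : Set V)) ∧ S.card = n}

/-- `tw(G) ≤ k`: `G` admits a tree decomposition of width at most `k`. -/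
def TreewidthLE {V : Type} (G : SimpleGraph V) (k : ℕ) : Prop :=
  ∃ (ι : Type) (T : SimpleGraph ι) (bag : ι → Set V),
    T.IsTree ∧
    (∀ v : V, ∃ i, v ∈ bag i) ∧
    (∀ u v : V, G.Adj u v → ∃ i, u ∈ bag i ∧ v ∈ bag i) ∧
    (∀ v : V, (T.induce {i | v ∈ bag i}).Connected) ∧
    (∀ i, (bag i).ncard ≤ k + 1)

/-- `G` is a `k`-tree: its vertices admit a construction order in which the first
`k+1` vertices form a complete graph and every later vertex is joined to exactly
`k` earlier, pairwise adjacent, vertices. -/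
def IsKTree (k : ℕ) {V : Type} (G : SimpleGraph V) : Prop :=
  ∃ (n : ℕ) (e : Fin n ≃ V), k + 1 ≤ n ∧
    (∀ i j : Fin n, (i : ℕ) < k + 1 → (j : ℕ) < k + 1 → i ≠ j → G.Adj (e i) (e j)) ∧
    (∀ j : Fin n, k + 1 ≤ (j : ℕ) →
      {i : Fin n | i < j ∧ G.Adj (e i) (e j)}.ncard = k ∧
      (∀ i i' : Fin n, i < j → i' < j → G.Adj (e i) (e j) → G.Adj (e i') (e j) →
        i ≠ i' → G.Adj (e i) (e i')))

/-- `S` is a dominating set of `G`. -/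
def IsDomSet {V : Type} (G : SimpleGraph V) (S : Set V) : Prop :=
  ∀ v : V, v ∈ S ∨ ∃ u ∈ S, G.Adj u v

/-- `S` is a connected dominating set of `G`. -/
def IsConnDomSet {V : Type} (G : SimpleGraph V) (S : Set V) : Prop :=
  IsDomSet G S ∧ (G.induce S).Connected

/-- The domination number `γ(G)`. -/
noncomputable def domNum {V : Type} [Fintype V] (G : SimpleGraph V) : ℕ :=
  sInf {n | ∃ S : Finset V, IsDomSet G ↑S ∧ S.card = n}

/-- The connected domination number `γ_c(G)`. -/
noncomputable def connDomNum {V : Type} [Fintype V] (G : SimpleGraph V) : ℕ :=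
  sInf {n | ∃ S : Finset V, IsConnDomSet G ↑S ∧ S.card = n}

/-- A graph is Eulerian if every vertex has even degree. -/
def IsEulerian {V : Type} (G : SimpleGraph V) : Prop :=
  ∀ v : V, Even (G.neighborSet v).ncard

/-- `G` contains a subgraph isomorphic to `H`. -/
def ContainsCopy {W V : Type} (H : SimpleGraph W) (G : SimpleGraph V) : Prop :=
  ∃ f : H →g G, Function.Injective ⇑f

/-- The complete tripartite graph `K_{1,1,3}`. -/
def K113 : SimpleGraph (Fin 5) :=
  SimpleGraph.fromEdgeSet {s(0, 1), s(0, 2), s(0, 3), s(0, 4), s(1, 2), s(1, 3), s(1, 4)}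

/-- `G` is a maximal outerplanar graph. -/
def IsMaximalOuterplanar {V : Type} (G : SimpleGraph V) : Prop :=
  IsOuterplanar G ∧ ∀ u v : V, u ≠ v → ¬ G.Adj u v →
    ¬ IsOuterplanar (G ⊔ SimpleGraph.fromEdgeSet {s(u, v)})

namespace PlaneEmbedding

variable {V : Type} {G : SimpleGraph V}

lemma vtx_left_mem_arc (E : PlaneEmbedding G) {u v : V} (h : G.Adj u v) :
    E.vtx u ∈ E.arc h := by
  obtain ⟨γ, -, hr⟩ := E.arc_path h
  exact hr ▸ ⟨0, γ.source⟩

lemma vtx_right_mem_arc (E : PlaneEmbedding G) {u v : V} (h : G.Adj u v) :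
    E.vtx v ∈ E.arc h := by
  obtain ⟨γ, -, hr⟩ := E.arc_path h
  exact hr ▸ ⟨1, γ.target⟩

lemma isCompact_arc (E : PlaneEmbedding G) {u v : V} (h : G.Adj u v) :
    IsCompact (E.arc h) := by
  obtain ⟨γ, -, hr⟩ := E.arc_path h
  exact hr ▸ isCompact_range γ.continuous

lemma isPreconnected_arc (E : PlaneEmbedding G) {u v : V} (h : G.Adj u v) :
    IsPreconnected (E.arc h) := by
  obtain ⟨γ, -, hr⟩ := E.arc_path h
  exact hr ▸ isPreconnected_range γ.continuous

lemma mem_subSupport {E : PlaneEmbedding G} {S : Set V} {z : ℝ × ℝ} :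
    z ∈ E.subSupport S ↔ (∃ u ∈ S, E.vtx u = z) ∨
      ∃ u ∈ S, ∃ v ∈ S, ∃ h : G.Adj u v, z ∈ E.arc h := by
  simp [subSupport]

lemma vtx_mem_subSupport (E : PlaneEmbedding G) {S : Set V} {u : V} (hu : u ∈ S) :
    E.vtx u ∈ E.subSupport S :=
  mem_subSupport.2 (.inl ⟨u, hu, rfl⟩)

lemma arc_subset_subSupport (E : PlaneEmbedding G) {S : Set V} {u v : V} (hu : u ∈ S)
    (hv : v ∈ S) (h : G.Adj u v) : E.arc h ⊆ E.subSupport S :=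
  fun _ hz => mem_subSupport.2 (.inr ⟨u, hu, v, hv, h, hz⟩)

lemma isCompact_subSupport [Finite V] (E : PlaneEmbedding G) (S : Set V) :
    IsCompact (E.subSupport S) := by
  refine (S.toFinite.image _).isCompact.union ?_
  refine isCompact_iUnion fun u => isCompact_iUnion fun _ => isCompact_iUnion fun v =>
    isCompact_iUnion fun _ => isCompact_iUnion fun h => E.isCompact_arc h

lemma vtx_notMem_subSupport (E : PlaneEmbedding G) {S : Set V} {w : V} (hw : w ∉ S) :
    E.vtx w ∉ E.subSupport S := by
  rw [mem_subSupport]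
  rintro (⟨u, hu, h⟩ | ⟨u, hu, v, hv, h, hz⟩)
  · exact hw (E.vtx_inj h ▸ hu)
  · rcases E.arc_vtx h w hz with rfl | rfl <;> contradiction

/-- An arc with an endpoint outside `S` meets the drawing of `S` only in the other endpoint. -/
lemma eq_vtx_of_mem_arc_of_mem_subSupport (E : PlaneEmbedding G) {S : Set V} {u v : V}
    (hu : u ∉ S) (h : G.Adj u v) {z : ℝ × ℝ} (hz : z ∈ E.arc h) (hzS : z ∈ E.subSupport S) :
    v ∈ S ∧ z = E.vtx v := by
  rcases mem_subSupport.1 hzS with ⟨w, hw, rfl⟩ | ⟨a, ha, b, hb, hab, hz'⟩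
  · rcases E.arc_vtx h w hz with rfl | rfl
    · contradiction
    · exact ⟨hw, rfl⟩
  · have hne : s(u, v) ≠ s(a, b) := by
      intro he
      rcases Sym2.eq_iff.1 he with ⟨rfl, rfl⟩ | ⟨rfl, rfl⟩ <;> contradiction
    obtain ⟨h1, h2⟩ := E.arc_inter h hab hne ⟨hz, hz'⟩
    rcases h1 with rfl | rfl
    · rcases h2 with h2 | h2 <;> rw [E.vtx_inj h2] at hu <;> contradiction
    · refine ⟨?_, rfl⟩
      rcases h2 with h2 | h2 <;> rwa [E.vtx_inj h2]

/-- The image of a plane drawing under a map that is continuous and injective on the drawing. -/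
def map (E : PlaneEmbedding G) (f : ℝ × ℝ → ℝ × ℝ)
    (hc : ContinuousOn f (E.subSupport Set.univ)) (hi : Set.InjOn f (E.subSupport Set.univ)) :
    PlaneEmbedding G where
  vtx v := f (E.vtx v)
  vtx_inj u v h := E.vtx_inj
    (hi (E.vtx_mem_subSupport (Set.mem_univ _)) (E.vtx_mem_subSupport (Set.mem_univ _)) h)
  arc _ _ h := f '' E.arc h
  arc_symm u v h := by rw [E.arc_symm h]
  arc_path u v h := by
    obtain ⟨γ, hγ, hr⟩ := E.arc_path h
    have hm : ∀ t, γ t ∈ E.subSupport Set.univ := fun t =>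
      E.arc_subset_subSupport (Set.mem_univ _) (Set.mem_univ _) h (hr ▸ ⟨t, rfl⟩)
    refine ⟨⟨⟨f ∘ γ, hc.comp_continuous γ.continuous hm⟩, by simp, by simp⟩, ?_, ?_⟩
    · exact fun s t hst => hγ (hi (hm s) (hm t) hst)
    · rw [← hr, ← Set.range_comp]
      rfl
  arc_vtx u v h w := by
    rintro ⟨z, hz, hzw⟩
    have := hi (E.arc_subset_subSupport (Set.mem_univ _) (Set.mem_univ _) h hz)
      (E.vtx_mem_subSupport (Set.mem_univ _)) hzw
    exact E.arc_vtx h w (this ▸ hz)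
  arc_inter u v a b h₁ h₂ hne := by
    rintro _ ⟨⟨z, hz, rfl⟩, ⟨z', hz', he⟩⟩
    obtain rfl := hi (E.arc_subset_subSupport (Set.mem_univ _) (Set.mem_univ _) h₂ hz')
      (E.arc_subset_subSupport (Set.mem_univ _) (Set.mem_univ _) h₁ hz) he
    obtain ⟨h1, h2⟩ := E.arc_inter h₁ h₂ hne ⟨hz, hz'⟩
    refine ⟨h1.imp (congrArg f) (congrArg f), h2.imp (congrArg f) (congrArg f)⟩

lemma subSupport_map (E : PlaneEmbedding G) (f : ℝ × ℝ → ℝ × ℝ)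
    (hc : ContinuousOn f (E.subSupport Set.univ)) (hi : Set.InjOn f (E.subSupport Set.univ))
    (S : Set V) : (E.map f hc hi).subSupport S = f '' E.subSupport S := by
  simp only [subSupport, map, Set.image_union, Set.image_iUnion, Set.image_image]

/-- The inherited drawing of an induced subgraph. -/
def induce (E : PlaneEmbedding G) (S : Set V) : PlaneEmbedding (G.induce S) where
  vtx v := E.vtx v
  vtx_inj := E.vtx_inj.comp Subtype.val_injective
  arc u v h := E.arc (SimpleGraph.induce_adj.1 h)
  arc_symm u v h := E.arc_symm _
  arc_path u v h := E.arc_path _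
  arc_vtx u v h w hw := (E.arc_vtx _ w hw).imp Subtype.ext Subtype.ext
  arc_inter u v a b h₁ h₂ hne := E.arc_inter _ _ fun he => hne <| by
    simpa [Subtype.ext_iff] using he

lemma subSupport_induce (E : PlaneEmbedding G) (S : Set V) :
    (E.induce S).subSupport Set.univ = E.subSupport S := by
  ext z
  simp only [mem_subSupport, induce, Set.mem_univ, true_and, Subtype.exists, exists_prop]
  exact or_congr Iff.rfl ⟨fun ⟨u, hu, v, hv, h, hz⟩ => ⟨u, hu, v, hv, h, hz⟩,
    fun ⟨u, hu, v, hv, h, hz⟩ => ⟨u, hu, v, hv, h, hz⟩⟩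

end PlaneEmbedding

/-- The map `z ↦ c / (z - p)` of the plane, in real coordinates. -/
noncomputable def planeInversion (c : ℂ) (p z : ℝ × ℝ) : ℝ × ℝ :=
  Complex.equivRealProdCLM (c * (Complex.equivRealProdCLM.symm (z - p))⁻¹)

lemma planeInversion_injective {c : ℂ} (hc : c ≠ 0) (p : ℝ × ℝ) :
    Function.Injective (planeInversion c p) := by
  intro z w h
  have := mul_left_cancel₀ hc (Complex.equivRealProdCLM.injective h)
  exact sub_left_injective (Complex.equivRealProdCLM.symm.injective (inv_injective this))

lemma continuousAt_planeInversion (c : ℂ) {p z : ℝ × ℝ} (h : z ≠ p) :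
    ContinuousAt (planeInversion c p) z := by
  have h0 : Complex.equivRealProdCLM.symm (z - p) ≠ 0 := by
    simpa [sub_eq_zero] using h
  refine Complex.equivRealProdCLM.continuous.continuousAt.comp ?_
  refine continuousAt_const.mul (ContinuousAt.inv₀ ?_ h0)
  exact (Complex.equivRealProdCLM.symm.continuous.comp
    (continuous_id.sub continuous_const)).continuousAt

lemma continuousOn_planeInversion (c : ℂ) {p : ℝ × ℝ} {D : Set (ℝ × ℝ)} (h : p ∉ D) :
    ContinuousOn (planeInversion c p) D := fun _ hz =>
  (continuousAt_planeInversion c (ne_of_mem_of_not_mem hz h)).continuousWithinAt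

/-- An inversion maps every set accumulating at its centre to an unbounded set. -/
lemma not_isBounded_planeInversion_image {c : ℂ} (hc : c ≠ 0) {p : ℝ × ℝ} {C : Set (ℝ × ℝ)}
    (hp : p ∉ C) (hC : p ∈ closure C) : ¬ Bornology.IsBounded (planeInversion c p '' C) := by
  intro hb
  obtain ⟨R, hR⟩ := (Complex.equivRealProdCLM.symm.lipschitz.isBounded_image hb).exists_norm_le
  have h1 : Filter.Tendsto (fun z : ℝ × ℝ => Complex.equivRealProdCLM.symm (z - p))
      (nhdsWithin p {p}ᶜ) (nhdsWithin 0 {0}ᶜ) := by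
    refine tendsto_nhdsWithin_iff.2 ⟨?_, ?_⟩
    · have : ContinuousAt (fun z : ℝ × ℝ => Complex.equivRealProdCLM.symm (z - p)) p :=
        (Complex.equivRealProdCLM.symm.continuous.comp
          (continuous_id.sub continuous_const)).continuousAt
      have h := this.tendsto
      simp only [sub_self, map_zero] at h
      exact h.mono_left nhdsWithin_le_nhds
    · filter_upwards [self_mem_nhdsWithin] with z hz
      simpa [sub_eq_zero] using hz
  have h2 := tendsto_norm_cobounded_atTop.comp
    ((Filter.tendsto_mul_left_cobounded hc).comp (Filter.tendsto_inv₀_nhdsNE_zero.comp h1))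
  have h3 := h2.eventually (Filter.eventually_gt_atTop R)
  have h4 : (nhdsWithin p C).NeBot := mem_closure_iff_nhdsWithin_neBot.1 hC
  have h5 : nhdsWithin p C ≤ nhdsWithin p {p}ᶜ :=
    nhdsWithin_mono _ fun z hz => ne_of_mem_of_not_mem hz hp
  obtain ⟨z, hz, hzF⟩ := ((h3.filter_mono h5).and self_mem_nhdsWithin).exists
  have := hR _ ⟨_, ⟨z, hzF, rfl⟩, rfl⟩
  simp only [planeInversion, ContinuousLinearEquiv.symm_apply_apply] at this
  exact absurd hz (not_lt.2 this)

/-- A point `q` of an open connected set can be joined to another point `p` of it within the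
set without hitting `p`. -/
lemma IsOpen.exists_isPreconnected_notMem_mem_closure {X : Type*} [NormedAddCommGroup X]
    [NormedSpace ℝ X] {F : Set X} (hF : IsOpen F) (hc : IsConnected F) {p q : X} (hp : p ∈ F)
    (hq : q ∈ F) (hne : q ≠ p) :
    ∃ C ⊆ F, IsPreconnected C ∧ q ∈ C ∧ p ∉ C ∧ p ∈ closure C := by
  obtain ⟨γ, hγ⟩ := (hF.isConnected_iff_isPathConnected.1 hc).joinedIn p hp q hq
  have hcl : IsClosed {t | γ t = p} := isClosed_eq γ.continuous continuous_const
  obtain ⟨t, ht, hmax⟩ := hcl.isCompact.exists_isGreatest ⟨0, γ.source⟩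
  have ht1 : t < 1 := by
    refine lt_of_le_of_ne unitInterval.le_one' ?_
    rintro rfl
    exact hne (γ.target.symm.trans ht)
  refine ⟨γ '' Set.Ioi t, ?_, ?_, ⟨1, ht1, γ.target⟩, ?_, ?_⟩
  · rintro _ ⟨s, -, rfl⟩
    exact hγ s
  · exact Set.ordConnected_Ioi.isPreconnected.image _ γ.continuous.continuousOn
  · rintro ⟨s, hs, hsp⟩
    exact absurd (hmax hsp) (not_le.2 hs)
  · have h1 : t ∈ closure (Set.Ioi t) := by
      rw [closure_Ioi' (a := t) ⟨1, ht1⟩]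
      exact Set.self_mem_Ici
    have := image_closure_subset_closure_image γ.continuous ⟨t, h1, rfl⟩
    rwa [ht] at this

namespace PlaneEmbedding

variable {V : Type} {G : SimpleGraph V}

/-- The drawing of a connected vertex set `S` lies in a single face of the drawing of `Sᶜ`. -/
lemma vtx_mem_connectedComponentIn (E : PlaneEmbedding G) {S : Set V}
    (hS : (G.induce S).Preconnected) {u v : V} (hu : u ∈ S) (hv : v ∈ S) :
    E.vtx v ∈ connectedComponentIn (E.subSupport Sᶜ)ᶜ (E.vtx u) := by
  obtain ⟨W⟩ := hS ⟨u, hu⟩ ⟨v, hv⟩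
  have key : ∀ a b : S, (G.induce S).Walk a b →
      E.vtx b ∈ connectedComponentIn (E.subSupport Sᶜ)ᶜ (E.vtx a) := by
    intro a b W
    induction W with
    | @nil a => exact mem_connectedComponentIn (E.vtx_notMem_subSupport (by simp))
    | @cons a b c h W ih =>
      have hab : G.Adj a b := h
      have hsub : E.arc hab ⊆ (E.subSupport Sᶜ)ᶜ := fun z hz hz' =>
        (E.eq_vtx_of_mem_arc_of_mem_subSupport (by simp) hab hz hz').1 b.2
      have hb := (E.isPreconnected_arc hab).subset_connectedComponentIn
        (E.vtx_left_mem_arc hab) hsub (E.vtx_right_mem_arc hab)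
      rwa [connectedComponentIn_eq hb]
  exact key _ _ W

lemma vtx_mem_closure_connectedComponentIn (E : PlaneEmbedding G) {S : Set V}
    (hS : IsConnDomSet G S) {u v : V} (hu : u ∈ S) :
    E.vtx v ∈ closure (connectedComponentIn (E.subSupport Sᶜ)ᶜ (E.vtx u)) := by
  by_cases hv : v ∈ S
  · exact subset_closure (E.vtx_mem_connectedComponentIn hS.2.preconnected hu hv)
  obtain ⟨w, hw, hwv⟩ := (hS.1 v).resolve_left hv
  obtain ⟨γ, hγ, hr⟩ := E.arc_path hwv
  have hpre : IsPreconnected (γ '' Set.Iio 1) :=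
    (Set.ordConnected_Iio.isPreconnected).image _ γ.continuous.continuousOn
  have hsub : γ '' Set.Iio 1 ⊆ (E.subSupport Sᶜ)ᶜ := by
    rintro _ ⟨t, ht, rfl⟩ hz
    have := (E.eq_vtx_of_mem_arc_of_mem_subSupport (by simpa using hw) hwv
      (hr ▸ ⟨t, rfl⟩) hz).2
    exact ne_of_lt ht (hγ (this.trans γ.target.symm))
  have hmem : E.vtx w ∈ γ '' Set.Iio 1 := ⟨0, by simp, γ.source⟩
  have hF := hpre.subset_connectedComponentIn hmem hsub
  rw [← connectedComponentIn_eq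
    (E.vtx_mem_connectedComponentIn hS.2.preconnected hu hw)] at hF
  refine closure_mono hF ?_
  have h1 : (1 : unitInterval) ∈ closure (Set.Iio 1) := by
    rw [closure_Iio' ⟨0, by simp⟩]
    simp
  simpa using image_closure_subset_closure_image γ.continuous ⟨1, h1, rfl⟩

end PlaneEmbedding

theorem isOuterplanar_induce_compl_of_isConnDomSet {V : Type} [Finite V] {G : SimpleGraph V}
    (hG : IsPlanar G) {S : Set V} (hS : IsConnDomSet G S) : IsOuterplanar (G.induce Sᶜ) := by
  obtain ⟨E⟩ := hG
  obtain ⟨⟨u, hu⟩⟩ := hS.2.nonempty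
  have hpD := E.vtx_notMem_subSupport (S := Sᶜ) (w := u) (by simpa using hu)
  generalize hp : E.vtx u = p at hpD
  have hinj := planeInversion_injective one_ne_zero p
  refine ⟨(E.induce Sᶜ).map (planeInversion 1 p)
    (continuousOn_planeInversion 1 (by rwa [E.subSupport_induce])) hinj.injOn, ?_⟩
  rintro ⟨v, hv⟩ -
  have hDsupp : ((E.induce Sᶜ).map (planeInversion 1 p)
    (continuousOn_planeInversion 1 (by rwa [E.subSupport_induce])) hinj.injOn).subSupport
      Set.univ = planeInversion 1 p '' E.subSupport Sᶜ := by
    rw [PlaneEmbedding.subSupport_map, E.subSupport_induce]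
  rw [hDsupp]
  have hvp : E.vtx v ≠ p := by
    rintro rfl
    exact hv (E.vtx_inj hp ▸ hu)
  have hvF := E.vtx_mem_closure_connectedComponentIn hS (v := v) hu
  rw [hp] at hvF
  set D := E.subSupport Sᶜ
  set F := connectedComponentIn Dᶜ p
  have hFo : IsOpen F :=
    (E.isCompact_subSupport _).isClosed.isOpen_compl.connectedComponentIn
  have hFc : IsConnected F := isConnected_connectedComponentIn_iff.2 hpD
  have hvF' : E.vtx v ∈ closure ({p}ᶜ ∩ F) :=
    isOpen_compl_singleton.inter_closure ⟨hvp, hvF⟩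
  have himg := (continuousAt_planeInversion 1 hvp).continuousWithinAt.mem_closure_image hvF'
  refine closure_mono ?_ himg
  rintro _ ⟨q, ⟨hqp, hqF⟩, rfl⟩
  have hsub : planeInversion 1 p '' F ⊆ (planeInversion 1 p '' D)ᶜ := by
    rintro _ ⟨q, hq, rfl⟩ ⟨q', hq', he⟩
    exact connectedComponentIn_subset _ _ hq (hinj he ▸ hq')
  obtain ⟨C, hCF, hC, hqC, hpC, hpC'⟩ := hFo.exists_isPreconnected_notMem_mem_closure hFc
    (mem_connectedComponentIn hpD) hqF hqp
  refine ⟨hsub ⟨q, hqF, rfl⟩, fun hb =>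
    not_isBounded_planeInversion_image one_ne_zero hpC hpC' (hb.subset ?_)⟩
  exact (hC.image _ (continuousOn_planeInversion 1 hpC)).subset_connectedComponentIn
    ⟨q, hqC, rfl⟩ ((Set.image_mono hCF).trans hsub)

/-- Two segments of the same length issuing from a common point and sharing a further point
have the same endpoint. -/
lemma eq_of_mem_segment_of_dist_eq {X : Type*} [NormedAddCommGroup X] [NormedSpace ℝ X]
    {c x y z : X} {r : ℝ} (hr : 0 < r) (hx : dist x c = r) (hy : dist y c = r)
    (hzx : z ∈ segment ℝ c x) (hzy : z ∈ segment ℝ c y) (hz : z ≠ c) : x = y := by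
  rw [segment_eq_image'] at hzx hzy
  obtain ⟨s, hs, rfl⟩ := hzx
  obtain ⟨t, ht, h⟩ := hzy
  rw [dist_eq_norm] at hx hy
  simp only [add_right_inj] at h
  have hst := congrArg norm h
  rw [norm_smul, norm_smul, hx, hy, Real.norm_of_nonneg hs.1, Real.norm_of_nonneg ht.1] at hst
  obtain rfl := mul_right_cancel₀ hr.ne' hst
  have ht0 : t ≠ 0 := by
    rintro rfl
    simp at hz
  have := smul_right_injective X ht0 h
  exact (sub_left_injective this).symm

lemma dist_le_of_mem_segment {X : Type*} [NormedAddCommGroup X] [NormedSpace ℝ X]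
    {c x z : X} {r : ℝ} (hx : dist x c = r) (hz : z ∈ segment ℝ c x) : dist z c ≤ r := by
  refine (convex_closedBall c r).segment_subset ?_ (Metric.mem_closedBall.2 hx.le) hz
  exact Metric.mem_closedBall_self (hx ▸ dist_nonneg)

/-- The initial part of an injective path, up to its last visit to a ball around its source, can
be replaced by a radius of that ball. -/
lemma Path.exists_radial {X : Type*} [NormedAddCommGroup X] [NormedSpace ℝ X] {c b : X}
    (γ : Path c b) (hγ : Function.Injective γ) {r : ℝ} (hr : 0 < r) (hb : r < dist b c) :
    ∃ x ∈ Set.range γ, dist x c = r ∧ ∃ γ' : Path c b, Function.Injective γ' ∧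
      Set.range γ' ⊆ segment ℝ c x ∪ (Set.range γ \ Metric.closedBall c r) := by
  have hd : Continuous fun t => dist (γ t) c := γ.continuous.dist continuous_const
  have hIVT : ∀ t, dist (γ t) c ≤ r → ∃ s, t ≤ s ∧ dist (γ s) c = r := by
    intro t ht
    obtain ⟨s, hs, hs'⟩ := intermediate_value_Icc (unitInterval.le_one' (t := t))
      hd.continuousOn ⟨ht, by simpa using hb.le⟩
    exact ⟨s, hs.1, hs'⟩
  obtain ⟨s₀, -, hs₀⟩ := hIVT 0 (by simpa using hr.le)
  obtain ⟨t, ht, hmax⟩ :=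
    (isClosed_eq hd continuous_const : IsClosed {t | dist (γ t) c = r}).isCompact.exists_isGreatest
      ⟨s₀, hs₀⟩
  have hafter : ∀ s, t < s → r < dist (γ s) c := by
    intro s hs
    by_contra! h
    obtain ⟨s', hs', h'⟩ := hIVT s h
    exact absurd (hs.trans_le hs') (not_lt.2 (hmax h'))
  have ht0 : (0 : ℝ) < t := by
    refine lt_of_le_of_ne t.2.1 fun h => ?_
    have : t = 0 := Subtype.ext h.symm
    rw [Set.mem_ofPred_eq, this, γ.source, dist_self] at ht
    exact hr.ne ht
  have ht1 : t < 1 := by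
    refine lt_of_le_of_ne unitInterval.le_one' ?_
    rintro rfl
    rw [Set.mem_ofPred_eq, γ.target] at ht
    exact hb.ne' ht
  let g : unitInterval → X := fun s =>
    if s ≤ t then c + ((s : ℝ) / t) • (γ t - c) else γ s
  have hgc : Continuous g := by
    refine Continuous.if_le (by fun_prop) γ.continuous continuous_id continuous_const ?_
    rintro s rfl
    simp [div_self ht0.ne']
  have hgd : ∀ s ≤ t, dist (g s) c = s / t * r := by
    intro s hs
    have hnn : (0 : ℝ) ≤ s / t := div_nonneg s.2.1 ht0.le
    have ht' : ‖γ t - c‖ = r := by rw [← dist_eq_norm]; exact ht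
    simp only [g, if_pos hs, dist_eq_norm, add_sub_cancel_left, norm_smul, ht',
      Real.norm_of_nonneg hnn]
  have hle1 : ∀ s ≤ t, (s : ℝ) / t ≤ 1 := fun s hs => (div_le_one ht0).2 hs
  have hgd' : ∀ s ≤ t, dist (g s) c ≤ r := by
    intro s hs
    rw [hgd s hs]
    exact mul_le_of_le_one_left hr.le (hle1 s hs)
  have hgt : ∀ s, t < s → g s = γ s := fun s hs => if_neg (not_le.2 hs)
  refine ⟨γ t, ⟨t, rfl⟩, ht, ⟨⟨g, hgc⟩, ?_, ?_⟩, ?_, ?_⟩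
  · simp [g]
  · simp [hgt 1 ht1]
  · intro s s' h
    change g s = g s' at h
    rcases le_or_gt s t with hs | hs <;> rcases le_or_gt s' t with hs' | hs'
    · have := hgd s hs
      rw [h, hgd s' hs'] at this
      have := (div_left_inj' ht0.ne').1 (mul_right_cancel₀ hr.ne' this)
      exact Subtype.ext this.symm
    · have := hafter s' hs'
      rw [← hgt s' hs', ← h] at this
      exact absurd this (not_lt.2 (hgd' s hs))
    · have := hafter s hs
      rw [← hgt s hs, h] at this
      exact absurd this (not_lt.2 (hgd' s' hs'))
    · rw [hgt s hs, hgt s' hs'] at h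
      exact hγ h
  · rintro _ ⟨s, rfl⟩
    change g s ∈ _
    rcases le_or_gt s t with hs | hs
    · left
      rw [segment_eq_image']
      exact ⟨s / t, ⟨div_nonneg s.2.1 ht0.le, hle1 s hs⟩, (if_pos hs).symm⟩
    · right
      rw [hgt s hs]
      exact ⟨⟨s, rfl⟩, fun h => absurd (hafter s hs) (not_lt.2 (Metric.mem_closedBall.1 h))⟩

namespace PlaneEmbedding

variable {V : Type} {G : SimpleGraph V}

/-- Every finite plane drawing can be changed near a vertex so that all edges leave it along
straight segments of the same length. -/
lemma exists_radial_at [Finite V] (E : PlaneEmbedding G) (u : V) :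
    ∃ (E' : PlaneEmbedding G) (r : ℝ) (X : Set (ℝ × ℝ)), 0 < r ∧ X.Finite ∧
      (∀ x ∈ X, dist x (E'.vtx u) = r) ∧
      ∀ z ∈ E'.subSupport Set.univ, dist z (E'.vtx u) ≤ r → z ≠ E'.vtx u →
        ∃ x ∈ X, z ∈ segment ℝ (E'.vtx u) x := by
  classical
  set c := E.vtx u
  have hcl : (E.subSupport {u}ᶜ)ᶜ ∈ nhds c :=
    (E.isCompact_subSupport _).isClosed.isOpen_compl.mem_nhds
      (E.vtx_notMem_subSupport (by simp))
  obtain ⟨r, hr, hball⟩ := Metric.nhds_basis_closedBall.mem_iff.1 hcl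
  have hfar : ∀ z ∈ E.subSupport {u}ᶜ, ¬ dist z c ≤ r := fun z hz hzr =>
    hball (Metric.mem_closedBall.2 hzr) hz
  have hvfar : ∀ w, w ≠ u → ¬ dist (E.vtx w) c ≤ r := fun w hw =>
    hfar _ (E.vtx_mem_subSupport hw)
  have key : ∀ w, ∃ (P : Set (ℝ × ℝ)) (x : ℝ × ℝ), ∀ h : G.Adj u w,
      (∃ γ : Path c (E.vtx w), Function.Injective γ ∧ Set.range γ = P) ∧ x ∈ E.arc h ∧
      dist x c = r ∧ ∀ z ∈ P, z ∈ segment ℝ c x ∨ (z ∈ E.arc h ∧ ¬ dist z c ≤ r) := by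
    intro w
    by_cases h : G.Adj u w
    · obtain ⟨γ, hγ, hrg⟩ := E.arc_path h
      obtain ⟨x, hx, hxr, γ', hγ', hsub⟩ :=
        γ.exists_radial hγ hr (not_le.1 (hvfar w h.ne'))
      refine ⟨Set.range γ', x, fun _ => ⟨⟨γ', hγ', rfl⟩, hrg ▸ hx, hxr, ?_⟩⟩
      intro z hz
      rw [← hrg]
      exact hsub hz
    · exact ⟨∅, c, fun h' => absurd h' h⟩
  choose P x hP using key
  have hPvtx : ∀ {w}, G.Adj u w → ∀ v, E.vtx v ∈ P w → v = u ∨ v = w := by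
    intro w h v hv
    obtain ⟨-, -, hxr, hsub⟩ := hP w h
    rcases hsub _ hv with hv | ⟨hv, -⟩
    · by_contra! hne
      exact hvfar v hne.1 (dist_le_of_mem_segment hxr hv)
    · exact E.arc_vtx h v hv
  have hPP : ∀ {w v}, G.Adj u w → G.Adj u v → w ≠ v → ∀ z ∈ P w, z ∈ P v → z = c := by
    intro w v hw hv hne z hz hz'
    obtain ⟨-, hx, hxr, hsub⟩ := hP w hw
    obtain ⟨-, hy, hyr, hsub'⟩ := hP v hv
    have harc : ∀ z ∈ E.arc hw, z ∈ E.arc hv → z = c := by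
      intro z hz hz'
      obtain ⟨h1, h2⟩ := E.arc_inter hw hv (mt Sym2.congr_right.1 hne) ⟨hz, hz'⟩
      rcases h1 with h1 | h1
      · exact h1
      · rcases h2 with h2 | h2
        · exact h2
        · exact absurd (E.vtx_inj (h1.symm.trans h2)) hne
    rcases hsub z hz with h1 | ⟨h1, h1'⟩ <;> rcases hsub' z hz' with h2 | ⟨h2, h2'⟩
    · by_contra hzc
      have hxy := eq_of_mem_segment_of_dist_eq hr hxr hyr h1 h2 hzc
      rw [harc _ hx (hxy ▸ hy), dist_self] at hxr
      exact hr.ne hxr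
    · exact absurd (dist_le_of_mem_segment hxr h1) h2'
    · exact absurd (dist_le_of_mem_segment hyr h2) h1'
    · exact harc z h1 h2
  have hPE : ∀ {w a b}, G.Adj u w → ∀ h : G.Adj a b, a ≠ u → b ≠ u → ∀ z ∈ P w, z ∈ E.arc h →
      z = E.vtx w ∧ (z = E.vtx a ∨ z = E.vtx b) := by
    intro w a b hw h ha hb z hz hz'
    obtain ⟨-, hx, hxr, hsub⟩ := hP w hw
    have hzf := hfar z (E.arc_subset_subSupport ha hb h hz')
    rcases hsub z hz with h1 | ⟨h1, -⟩
    · exact absurd (dist_le_of_mem_segment hxr h1) hzf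
    · obtain ⟨h2, h3⟩ := E.arc_inter hw h (by
        intro he
        rcases Sym2.eq_iff.1 he with ⟨h, -⟩ | ⟨h, -⟩
        · exact ha h.symm
        · exact hb h.symm) ⟨h1, hz'⟩
      refine ⟨h2.resolve_left fun h => hzf ?_, h3⟩
      rw [h, dist_self]
      exact hr.le
  let E' : PlaneEmbedding G :=
    { vtx := E.vtx
      vtx_inj := E.vtx_inj
      arc := fun a b h => if a = u then P b else if b = u then P a else E.arc h
      arc_symm := by
        intro a b h
        by_cases ha : a = u <;> by_cases hb : b = u
        · exact absurd (ha.trans hb.symm) h.ne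
        · simp [ha, hb]
        · simp [ha, hb]
        · simp [ha, hb, E.arc_symm h]
      arc_path := by
        intro a b h
        split_ifs with ha hb
        · subst ha
          exact (hP b h).1
        · subst hb
          obtain ⟨γ, hγ, hrg⟩ := (hP a h.symm).1
          exact ⟨γ.symm, hγ.comp unitInterval.symm_bijective.injective, by rw [γ.symm_range, hrg]⟩
        · exact E.arc_path h
      arc_vtx := by
        intro a b h w hw
        split_ifs at hw with ha hb
        · subst ha
          exact hPvtx h w hw
        · subst hb
          exact (hPvtx h.symm w hw).symm
        · exact E.arc_vtx h w hw
      arc_inter := by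
        rintro a b a' b' h h' hne z ⟨hz, hz'⟩
        simp only [Set.mem_inter_iff, Set.mem_insert_iff, Set.mem_singleton_iff]
        split_ifs at hz with h1 h2 <;> split_ifs at hz' with h3 h4
        · subst h1 h3
          have := hPP h h' (mt Sym2.congr_right.2 hne) z hz hz'
          exact ⟨.inl this, .inl this⟩
        · subst h1 h4
          have := hPP h h'.symm (by rintro rfl; exact hne Sym2.eq_swap) z hz hz'
          exact ⟨.inl this, .inr this⟩
        · subst h1
          exact (hPE h h' h3 h4 z hz hz').imp_left .inr
        · subst h2 h3
          have := hPP h.symm h' (by rintro rfl; exact hne Sym2.eq_swap) z hz hz'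
          exact ⟨.inr this, .inl this⟩
        · subst h2 h4
          have := hPP h.symm h'.symm (mt Sym2.congr_left.2 hne) z hz hz'
          exact ⟨.inr this, .inr this⟩
        · subst h2
          exact (hPE h.symm h' h3 h4 z hz hz').imp_left .inl
        · subst h3
          exact (hPE h' h h1 h2 z hz' hz).symm.imp_right .inr
        · subst h4
          exact (hPE h'.symm h h1 h2 z hz' hz).symm.imp_right .inl
        · exact E.arc_inter h h' hne ⟨hz, hz'⟩ }
  refine ⟨E', r, x '' {w | G.Adj u w}, hr, Set.toFinite _, ?_, ?_⟩
  · rintro _ ⟨w, hw, rfl⟩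
    exact (hP w hw).2.2.1
  · intro z hz hzr hzc
    have hseg : ∀ w, G.Adj u w → z ∈ P w → ∃ y ∈ x '' {w | G.Adj u w}, z ∈ segment ℝ c y := by
      intro w hw hz
      exact ⟨x w, ⟨w, hw, rfl⟩, ((hP w hw).2.2.2 z hz).resolve_right fun h => h.2 hzr⟩
    rcases mem_subSupport.1 hz with ⟨w, -, rfl⟩ | ⟨a, -, b, -, h, hzh⟩
    · exact absurd hzr (hvfar w fun h => hzc (h ▸ rfl))
    · change z ∈ (if a = u then P b else if b = u then P a else E.arc h) at hzh
      split_ifs at hzh with ha hb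
      · subst ha
        exact hseg b h hzh
      · subst hb
        exact hseg a h.symm hzh
      · exact absurd hzr (hfar z (E.arc_subset_subSupport ha hb h hzh))

end PlaneEmbedding

/-- A finite planar graph has a drawing in which a prescribed vertex `u` sees infinity along a
straight ray. -/
lemma IsPlanar.exists_vtx_ray {V : Type} [Finite V] {G : SimpleGraph V} (hG : IsPlanar G)
    (u : V) : ∃ E : PlaneEmbedding G, E.vtx u = (1, 0) ∧
      ∀ s : ℝ, 1 ≤ s → (s, 0) ∈ E.subSupport Set.univ → s = 1 := by
  obtain ⟨E₀⟩ := hG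
  obtain ⟨E, r, X, hr, hX, hXr, hloc⟩ := E₀.exists_radial_at u
  set c := E.vtx u
  have hsphere : (Metric.sphere c r).Infinite := by
    have hinj : Set.InjOn (fun t : ℝ => c + (r, t)) (Set.Icc 0 r) := by
      intro s _ t _ h
      simpa using h
    refine ((Set.Icc_infinite hr).image hinj).mono ?_
    rintro _ ⟨t, ht, rfl⟩
    simp [Prod.norm_def, abs_of_pos hr, abs_of_nonneg ht.1, ht.2]
  obtain ⟨y, hy, hyX⟩ := hsphere.exists_notMem_finite hX
  have hyr : ‖y - c‖ = r := by
    rw [← dist_eq_norm]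
    exact hy
  have hyc : y - c ≠ 0 := norm_pos_iff.1 (hyr ▸ hr)
  have hfree : ∀ s : ℝ, 0 < s → s ≤ 1 → c + s • (y - c) ∉ E.subSupport Set.univ := by
    intro s hs hs1 hmem
    have hne : c + s • (y - c) ≠ c := by
      simpa using ⟨hs.ne', hyc⟩
    have hseg : c + s • (y - c) ∈ segment ℝ c y := by
      rw [segment_eq_image']
      exact ⟨s, ⟨hs.le, hs1⟩, rfl⟩
    obtain ⟨x, hx, hzx⟩ := hloc _ hmem (dist_le_of_mem_segment hy hseg) hne
    exact hyX (eq_of_mem_segment_of_dist_eq hr hy (hXr x hx) hseg hzx hne ▸ hx)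
  have hyD : y ∉ E.subSupport Set.univ := by simpa using hfree 1 one_pos le_rfl
  set k : ℂ := Complex.equivRealProdCLM.symm (c - y) with hk
  have hk0 : k ≠ 0 := by
    rw [hk, Ne, map_eq_zero_iff _ Complex.equivRealProdCLM.symm.injective, ← neg_sub, neg_eq_zero]
    exact hyc
  have hray : ∀ s : ℝ, s ≠ 0 → planeInversion k y (y + s⁻¹ • (c - y)) = (s, 0) := by
    intro s hs
    rw [planeInversion, add_sub_cancel_left, map_smul, ← hk, Complex.real_smul, mul_inv,
      mul_left_comm, mul_inv_cancel₀ hk0]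
    simp
  have hinj := planeInversion_injective hk0 y
  refine ⟨E.map (planeInversion k y) (continuousOn_planeInversion k hyD) hinj.injOn, ?_, ?_⟩
  · change planeInversion k y c = (1, 0)
    simpa using hray 1 one_ne_zero
  · intro s hs hmem
    have hs0 : 0 < s := one_pos.trans_le hs
    rw [PlaneEmbedding.subSupport_map, ← hray s hs0.ne', hinj.mem_set_image] at hmem
    by_contra hne
    have hlt : s⁻¹ < 1 := inv_lt_one_of_one_lt₀ (lt_of_le_of_ne hs (Ne.symm hne))
    refine hfree (1 - s⁻¹) (by linarith) (by linarith [inv_pos.2 hs0]) ?_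
    convert hmem using 1
    module

/-- Two drawings of `G` with disjoint supports, the first used on a union `A` of components and
the second on the rest, together with an arc joining them, yield a drawing of `G` with an extra
edge. -/
lemma isPlanar_sup_edge_of_disjoint {V : Type} {G : SimpleGraph V} (E₁ E₂ : PlaneEmbedding G)
    {A : Set V} (hA : ∀ a b, G.Adj a b → (a ∈ A ↔ b ∈ A)) {u v : V} (hu : u ∈ A) (hv : v ∉ A)
    (hdisj : Disjoint (E₁.subSupport Set.univ) (E₂.subSupport Set.univ))
    (γ : Path (E₁.vtx u) (E₂.vtx v)) (hγ : Function.Injective γ)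
    (h₁ : ∀ z ∈ Set.range γ, z ∈ E₁.subSupport Set.univ → z = E₁.vtx u)
    (h₂ : ∀ z ∈ Set.range γ, z ∈ E₂.subSupport Set.univ → z = E₂.vtx v) :
    IsPlanar (G ⊔ SimpleGraph.fromEdgeSet {s(u, v)}) := by
  classical
  have hd : ∀ {z}, z ∈ E₁.subSupport Set.univ → z ∉ E₂.subSupport Set.univ := fun h h' =>
    Set.disjoint_left.1 hdisj h h'
  have hadj : ∀ {a b}, (G ⊔ SimpleGraph.fromEdgeSet {s(u, v)}).Adj a b → ¬ G.Adj a b →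
      s(a, b) = s(u, v) := by
    intro a b h hn
    simpa using (h.resolve_left hn).1
  have hv₁ : ∀ w, E₁.vtx w ∈ E₁.subSupport Set.univ := fun w =>
    E₁.vtx_mem_subSupport (Set.mem_univ w)
  have hv₂ : ∀ w, E₂.vtx w ∈ E₂.subSupport Set.univ := fun w =>
    E₂.vtx_mem_subSupport (Set.mem_univ w)
  have ha₁ : ∀ {a b} (h : G.Adj a b) {z}, z ∈ E₁.arc h → z ∈ E₁.subSupport Set.univ :=
    fun h _ hz => E₁.arc_subset_subSupport (Set.mem_univ _) (Set.mem_univ _) h hz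
  have ha₂ : ∀ {a b} (h : G.Adj a b) {z}, z ∈ E₂.arc h → z ∈ E₂.subSupport Set.univ :=
    fun h _ hz => E₂.arc_subset_subSupport (Set.mem_univ _) (Set.mem_univ _) h hz
  let f : V → ℝ × ℝ := fun w => if w ∈ A then E₁.vtx w else E₂.vtx w
  have hf₁ : ∀ {w}, w ∈ A → f w = E₁.vtx w := fun h => if_pos h
  have hf₂ : ∀ {w}, w ∉ A → f w = E₂.vtx w := fun h => if_neg h
  have hfuv : ∀ {a b}, s(a, b) = s(u, v) →
      ({f a, f b} : Set (ℝ × ℝ)) = {E₁.vtx u, E₂.vtx v} := by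
    intro a b h
    rw [← hf₁ hu, ← hf₂ hv]
    rcases Sym2.eq_iff.1 h with ⟨rfl, rfl⟩ | ⟨rfl, rfl⟩
    · rfl
    · exact Set.pair_comm _ _
  -- The intersection of an old arc with the new one.
  have hold : ∀ {a b} (h : G.Adj a b) (z), z ∈ (if a ∈ A then E₁.arc h else E₂.arc h) →
      z ∈ Set.range γ →
      z ∈ ({f a, f b} : Set (ℝ × ℝ)) ∧ z ∈ ({E₁.vtx u, E₂.vtx v} : Set (ℝ × ℝ)) := by
    intro a b h z hz hzγ
    split_ifs at hz with ha
    · obtain rfl := h₁ z hzγ (ha₁ h hz)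
      rw [hf₁ ha, hf₁ ((hA a b h).1 ha)]
      refine ⟨?_, .inl rfl⟩
      exact (E₁.arc_vtx h u hz).imp (congrArg _) (congrArg _)
    · obtain rfl := h₂ z hzγ (ha₂ h hz)
      rw [hf₂ ha, hf₂ (mt (hA a b h).2 ha)]
      refine ⟨?_, .inr rfl⟩
      exact (E₂.arc_vtx h v hz).imp (congrArg _) (congrArg _)
  exact ⟨{
    vtx := f
    vtx_inj := by
      intro a b h
      by_cases ha : a ∈ A <;> by_cases hb : b ∈ A
      · rw [hf₁ ha, hf₁ hb] at h
        exact E₁.vtx_inj h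
      · rw [hf₁ ha, hf₂ hb] at h
        exact absurd (h ▸ hv₂ b) (hd (hv₁ a))
      · rw [hf₂ ha, hf₁ hb] at h
        exact absurd (h ▸ hv₂ a) (hd (hv₁ b))
      · rw [hf₂ ha, hf₂ hb] at h
        exact E₂.vtx_inj h
    arc := fun a b _ =>
      if h : G.Adj a b then if a ∈ A then E₁.arc h else E₂.arc h else Set.range γ
    arc_symm := by
      intro a b h
      by_cases hab : G.Adj a b
      · simp only [hab, hab.symm, dite_true, E₁.arc_symm hab, E₂.arc_symm hab, hA a b hab]
      · simp only [hab, mt SimpleGraph.Adj.symm hab, dite_false]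
    arc_path := by
      intro a b h
      split_ifs with hab ha
      · rw [hf₁ ha, hf₁ ((hA a b hab).1 ha)]
        exact E₁.arc_path hab
      · rw [hf₂ ha, hf₂ (mt (hA a b hab).2 ha)]
        exact E₂.arc_path hab
      · rcases Sym2.eq_iff.1 (hadj h hab) with ⟨rfl, rfl⟩ | ⟨rfl, rfl⟩
        · rw [hf₁ hu, hf₂ hv]
          exact ⟨γ, hγ, rfl⟩
        · rw [hf₁ hu, hf₂ hv]
          exact ⟨γ.symm, hγ.comp unitInterval.symm_bijective.injective, γ.symm_range⟩
    arc_vtx := by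
      intro a b h w hw
      split_ifs at hw with hab ha
      · by_cases hwA : w ∈ A
        · exact E₁.arc_vtx hab w (hf₁ hwA ▸ hw)
        · rw [hf₂ hwA] at hw
          exact absurd (hv₂ w) (hd (ha₁ hab hw))
      · by_cases hwA : w ∈ A
        · rw [hf₁ hwA] at hw
          exact absurd (ha₂ hab hw) (hd (hv₁ w))
        · exact E₂.arc_vtx hab w (hf₂ hwA ▸ hw)
      · have : w = u ∨ w = v := by
          by_cases hwA : w ∈ A
          · rw [hf₁ hwA] at hw
            exact .inl (E₁.vtx_inj (h₁ _ hw (hv₁ w)))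
          · rw [hf₂ hwA] at hw
            exact .inr (E₂.vtx_inj (h₂ _ hw (hv₂ w)))
        rcases Sym2.eq_iff.1 (hadj h hab) with ⟨rfl, rfl⟩ | ⟨rfl, rfl⟩
        · exact this
        · exact this.symm
    arc_inter := by
      rintro a b a' b' h h' hne z ⟨hz, hz'⟩
      by_cases hab : G.Adj a b <;> by_cases hab' : G.Adj a' b' <;>
        simp only [hab, hab', dite_true, dite_false] at hz hz'
      · split_ifs at hz hz' with ha ha' ha'
        · rw [hf₁ ha, hf₁ ha', hf₁ ((hA a b hab).1 ha), hf₁ ((hA a' b' hab').1 ha')]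
          exact E₁.arc_inter hab hab' hne ⟨hz, hz'⟩
        · exact absurd (ha₂ hab' hz') (hd (ha₁ hab hz))
        · exact absurd (ha₂ hab hz) (hd (ha₁ hab' hz'))
        · rw [hf₂ ha, hf₂ ha', hf₂ (mt (hA a b hab).2 ha), hf₂ (mt (hA a' b' hab').2 ha')]
          exact E₂.arc_inter hab hab' hne ⟨hz, hz'⟩
      · rw [hfuv (hadj h' hab')]
        exact hold hab z hz hz'
      · rw [hfuv (hadj h hab)]
        exact (hold hab' z hz' hz).symm
      · exact absurd ((hadj h hab).trans (hadj h' hab').symm) hne }⟩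

/-- In a finite planar graph, vertices in different components can be joined by an edge without
losing planarity. -/
lemma IsPlanar.sup_edge_of_not_reachable {V : Type} [Finite V] {G : SimpleGraph V}
    (hG : IsPlanar G) {u v : V} (huv : ¬ G.Reachable u v) :
    IsPlanar (G ⊔ SimpleGraph.fromEdgeSet {s(u, v)}) := by
  obtain ⟨E₁, hu, hray₁⟩ := hG.exists_vtx_ray u
  obtain ⟨E₀, hv, hray₀⟩ := hG.exists_vtx_ray v
  obtain ⟨R₁, hR₁⟩ := (E₁.isCompact_subSupport Set.univ).isBounded.exists_norm_le
  obtain ⟨R₀, hR₀⟩ := (E₀.isCompact_subSupport Set.univ).isBounded.exists_norm_le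
  have hR₁' : 1 ≤ R₁ := by
    have := hR₁ _ (E₁.vtx_mem_subSupport (Set.mem_univ u))
    rwa [hu, Prod.norm_def, norm_one, norm_zero, max_eq_left zero_le_one] at this
  have hR₀' : 1 ≤ R₀ := by
    have := hR₀ _ (E₀.vtx_mem_subSupport (Set.mem_univ v))
    rwa [hv, Prod.norm_def, norm_one, norm_zero, max_eq_left zero_le_one] at this
  set T := R₁ + R₀ + 1 with hT
  have hflip : Function.Injective fun z : ℝ × ℝ => ((T, 0) : ℝ × ℝ) - z := sub_right_injective
  let E₂ := E₀.map (fun z => (T, 0) - z) (by fun_prop) hflip.injOn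
  have hsupp : ∀ z, z ∈ E₂.subSupport Set.univ ↔ (T, 0) - z ∈ E₀.subSupport Set.univ := by
    intro z
    rw [PlaneEmbedding.subSupport_map]
    constructor
    · rintro ⟨w, hw, rfl⟩
      simpa using hw
    · exact fun h => ⟨_, h, by simp⟩
  have hv₂ : E₂.vtx v = (T - 1, 0) := by
    change (T, 0) - E₀.vtx v = _
    simp [hv]
  have hdisj : Disjoint (E₁.subSupport Set.univ) (E₂.subSupport Set.univ) := by
    refine Set.disjoint_left.2 fun z hz hz' => ?_
    have h1 := hR₁ z hz
    have h2 := hR₀ _ ((hsupp z).1 hz')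
    have h3 : ‖((T, 0) : ℝ × ℝ)‖ ≤ R₀ + R₁ := by
      rw [← sub_add_cancel ((T, 0) : ℝ × ℝ) z]
      exact norm_add_le_of_le h2 h1
    have h4 := (norm_fst_le ((T, 0) : ℝ × ℝ)).trans h3
    have h5 := (le_abs_self T).trans h4
    linarith
  let g : unitInterval → ℝ × ℝ := fun t => (1 + t * (T - 2), 0)
  have hT2 : 0 < T - 2 := by linarith
  let γ : Path (E₁.vtx u) (E₂.vtx v) :=
    ⟨⟨g, by fun_prop⟩, by simp [g, hu], by simp only [g, hv₂]; ext <;> simp; ring⟩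
  refine isPlanar_sup_edge_of_disjoint E₁ E₂ (A := {w | G.Reachable u w}) ?_
    (SimpleGraph.Reachable.refl u) huv hdisj γ ?_ ?_ ?_
  · exact fun a b h => ⟨fun h' => h'.trans h.reachable, fun h' => h'.trans h.symm.reachable⟩
  · intro s t h
    have h' : 1 + (s : ℝ) * (T - 2) = 1 + t * (T - 2) := congrArg Prod.fst h
    exact Subtype.ext (mul_right_cancel₀ hT2.ne' (add_left_cancel h'))
  · rintro _ ⟨t, rfl⟩ hz
    refine Eq.trans ?_ hu.symm
    have := hray₁ _ (by nlinarith [t.2.1]) hz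
    exact Prod.ext this rfl
  · rintro _ ⟨t, rfl⟩ hz
    refine Eq.trans ?_ hv₂.symm
    have h1 : (T, 0) - g t = (T - (1 + t * (T - 2)), 0) := by simp [g]
    have h2 := (hsupp _).1 hz
    change (T, 0) - g t ∈ _ at h2
    rw [h1] at h2
    have := hray₀ _ (by nlinarith [t.2.2]) h2
    exact Prod.ext (by change 1 + t * (T - 2) = T - 1; linarith) rfl

theorem IsPlaneTriangulation.preconnected {V : Type} [Finite V] {G : SimpleGraph V}
    (hG : IsPlaneTriangulation G) : G.Preconnected := by
  intro u v
  by_contra h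
  exact hG.2 u v (fun he => h (he ▸ SimpleGraph.Reachable.refl u)) (fun ha => h ha.reachable)
    (hG.1.sup_edge_of_not_reachable h)

/-- Let `G` be a plane triangulation and `S` a connected dominating
set of `G`. Then the induced subgraph `G − S` is outerplanar; consequently
`s_o(G) ≥ n − γ_c(G)`. -/
theorem stmt18 (V : Type) [Fintype V] (G : SimpleGraph V)
    (hG : IsPlaneTriangulation G) :
    (∀ S : Set V, IsConnDomSet G S → IsOuterplanar (G.induce Sᶜ)) ∧
    Fintype.card V - connDomNum G ≤ sO G := by
  classical
  have hout : ∀ S : Set V, IsConnDomSet G S → IsOuterplanar (G.induce Sᶜ) := fun S hS =>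
    isOuterplanar_induce_compl_of_isConnDomSet hG.1 hS
  refine ⟨hout, ?_⟩
  rcases isEmpty_or_nonempty V with hV | hV
  · simp [Fintype.card_eq_zero]
  have hne : {n | ∃ S : Finset V, IsConnDomSet G ↑S ∧ S.card = n}.Nonempty := by
    refine ⟨_, Finset.univ, ⟨fun v => .inl (by simp), ?_⟩, rfl⟩
    rw [Finset.coe_univ]
    exact (SimpleGraph.induceUnivIso G).connected_iff.2 ⟨hG.preconnected⟩
  obtain ⟨S, hS, hcard⟩ := Nat.sInf_mem hne
  refine le_csSup ⟨Fintype.card V, ?_⟩ ⟨Sᶜ, ?_, ?_⟩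
  · rintro _ ⟨T, -, rfl⟩
    exact T.card_le_univ
  · rw [Finset.coe_compl]
    exact hout S hS
  · rw [Finset.card_compl, hcard, connDomNum]
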